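/- arXiv:2205.11001 — 2 statements merged into one kernel-verified Lean document; each statement's English description precedes it below -/
import Mathlib

section
/- Fix an integer n ≥ 2. Let F be the free abelian group with basis {x_j^i : 1 ≤ i, j ≤ n} (so F ≅ ℤ^(n²)), and let N ≤ F be the subgroup generated by the following elements: (1) x_i^j − x_j^i for all 1 ≤ i < j ≤ n; (2) T₀ = Σ_{i=1}^n Σ_{j=1}^n x_j^i; (3) T_k = x_k^k for each 1 ≤ k ≤ n; and (4) C = Σ_{i=1}^n Σ_{j=1}^i x_j^i. Then the quotient group F / N is a free abelian group. -/
/-- The pairwise differences of the symmetrized off-diagonal coordinates `v (i, j) + v (j, i)`,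
taken relative to a fixed position `q`. -/
def symmDiffMap {n : ℕ} (q : Fin n × Fin n) :
    (Fin n × Fin n → ℤ) →ₗ[ℤ] ({p : Fin n × Fin n // p.1 ≠ p.2} → ℤ) :=
  let coord (p : Fin n × Fin n) : (Fin n × Fin n → ℤ) →ₗ[ℤ] ℤ := LinearMap.proj p
  LinearMap.pi fun p => (coord p.1 + coord p.1.swap) - (coord q + coord q.swap)

theorem mem_ker_symmDiffMap {n : ℕ} {q : Fin n × Fin n} {v : Fin n × Fin n → ℤ} :
    v ∈ LinearMap.ker (symmDiffMap q) ↔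
      ∀ p : Fin n × Fin n, p.1 ≠ p.2 → v p + v p.swap = v q + v q.swap := by
  simp only [LinearMap.mem_ker, funext_iff, Subtype.forall]
  exact forall₂_congr fun p _ => sub_eq_zero

theorem sum_sum_single_apply {n : ℕ} (p : Fin n × Fin n) :
    (∑ i : Fin n, ∑ j : Fin n, (Pi.single (i, j) 1 : Fin n × Fin n → ℤ)) p = 1 := by
  rw [← Fintype.sum_prod_type' fun i j => (Pi.single (i, j) 1 : Fin n × Fin n → ℤ)]
  simp [Finset.sum_apply, Pi.single_apply]

theorem sum_sum_Iic_single_apply {n : ℕ} (p : Fin n × Fin n) :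
    (∑ i : Fin n, ∑ j ∈ Finset.Iic i, (Pi.single (i, j) 1 : Fin n × Fin n → ℤ)) p =
      if p.2 ≤ p.1 then 1 else 0 := by
  obtain ⟨a, c⟩ := p
  simp only [Finset.sum_apply, Pi.single_apply, Prod.mk.injEq, ite_and]
  rw [Finset.sum_eq_single a] <;> simp +contextual [eq_comm]

/-- An integer matrix whose off-diagonal part is antisymmetric is a combination of diagonal
matrix units and differences of transposed matrix units. -/
theorem mem_of_antisymm_offDiag {n : ℕ} {N : Submodule ℤ (Fin n × Fin n → ℤ)}
    (hdiag : ∀ k : Fin n, Pi.single (k, k) 1 ∈ N)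
    (hsymm : ∀ i j : Fin n, i < j →
      (Pi.single (j, i) 1 - Pi.single (i, j) 1 : Fin n × Fin n → ℤ) ∈ N)
    {w : Fin n × Fin n → ℤ} (hw : ∀ p : Fin n × Fin n, p.1 ≠ p.2 → w p + w p.swap = 0) :
    w ∈ N := by
  have hsum : w = ∑ p : Fin n × Fin n,
      ((if p.2 ≤ p.1 then w p else 0) • (Pi.single p 1 : Fin n × Fin n → ℤ) -
        (if p.2 < p.1 then w p else 0) • (Pi.single p.swap 1 : Fin n × Fin n → ℤ)) := by
    ext q
    have hswap : ∀ p : Fin n × Fin n, q = p.swap ↔ q.swap = p := fun p =>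
      ⟨fun h => by simp [h], fun h => by simp [← h]⟩
    simp only [Finset.sum_apply, Pi.sub_apply, Pi.smul_apply, Pi.single_apply, smul_eq_mul,
      mul_ite, mul_one, mul_zero, Finset.sum_sub_distrib, hswap, Finset.sum_ite_eq,
      Finset.mem_univ, if_true, Prod.fst_swap, Prod.snd_swap]
    have := hw q
    grind
  rw [hsum]
  refine N.sum_mem fun p _ => ?_
  obtain ⟨i, j⟩ := p
  rcases lt_trichotomy i j with h | rfl | h
  · simp [h.not_ge, h.not_gt]
  · simpa using N.smul_mem (w (i, i)) (hdiag i)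
  · simpa only [h, h.le, if_true, smul_sub, Prod.swap_prod_mk] using
      N.smul_mem (w (i, j)) (hsymm j i h)

/-- Paper's Example 3.9. Let `F` be the free abelian group with basis
`{x_j^i : 1 ≤ i, j ≤ n}` (here `b (i, j)` is the basis element `x_j^i`, with
superscript `i` the first coordinate and subscript `j` the second), and let `N ≤ F`
be the subgroup generated by:
(1) `x_i^j − x_j^i` for all `i < j`;
(2) `T₀ = Σ_i Σ_j x_j^i`;
(3) `T_k = x_k^k` for each `k`;
(4) `C = Σ_i Σ_{j ≤ i} x_j^i`.
Then for `n ≥ 2` the quotient `F / N` is a free abelian group. -/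
theorem stmt_7 (n : ℕ) (hn : 2 ≤ n)
    (b : Fin n × Fin n → (Fin n × Fin n → ℤ))
    (hb : b = fun p => Pi.single p 1)
    (N : Submodule ℤ (Fin n × Fin n → ℤ))
    (hN : N = Submodule.span ℤ
      ({v | ∃ i j : Fin n, i < j ∧ v = b (j, i) - b (i, j)} ∪
       {∑ i : Fin n, ∑ j : Fin n, b (i, j)} ∪
       {v | ∃ k : Fin n, v = b (k, k)} ∪
       {∑ i : Fin n, ∑ j ∈ Finset.Iic i, b (i, j)})) :
    Module.Free ℤ ((Fin n × Fin n → ℤ) ⧸ N) := by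
  obtain ⟨q, hq⟩ : ∃ q : Fin n × Fin n, q.1 ≠ q.2 :=
    ⟨(⟨0, by omega⟩, ⟨1, by omega⟩), by simp⟩
  suffices hker : N = LinearMap.ker (symmDiffMap q) by
    rw [hker]
    exact Module.Free.of_equiv (symmDiffMap q).quotKerEquivRange.symm
  subst hb
  apply le_antisymm
  · rw [hN, Submodule.span_le]
    rintro v (((⟨i, j, hij, rfl⟩ | rfl) | ⟨k, rfl⟩) | rfl) <;>
      refine mem_ker_symmDiffMap.2 fun p hp => ?_
    · simp only [Pi.sub_apply, Pi.single_apply, Prod.ext_iff, Prod.fst_swap, Prod.snd_swap]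
      grind
    · simp only [sum_sum_single_apply]
    · simp only [Pi.single_apply, Prod.ext_iff, Prod.fst_swap, Prod.snd_swap]
      grind
    · simp only [sum_sum_Iic_single_apply, Prod.fst_swap, Prod.snd_swap]
      grind
  · intro v hv
    rw [mem_ker_symmDiffMap] at hv
    have hC : ∑ i : Fin n, ∑ j ∈ Finset.Iic i, (Pi.single (i, j) 1 : Fin n × Fin n → ℤ) ∈ N :=
      hN ▸ Submodule.subset_span (Or.inr rfl)
    rw [← N.sub_mem_iff_left (N.smul_mem (v q + v q.swap) hC)]
    refine mem_of_antisymm_offDiag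
      (fun k => hN ▸ Submodule.subset_span (Or.inl (Or.inr ⟨k, rfl⟩)))
      (fun i j hij => hN ▸ Submodule.subset_span (Or.inl (Or.inl (Or.inl ⟨i, j, hij, rfl⟩))))
      fun p hp => ?_
    have := hv p hp
    simp only [Pi.sub_apply, Pi.smul_apply, sum_sum_Iic_single_apply, smul_eq_mul,
      Prod.fst_swap, Prod.snd_swap]
    grind
end

section
/- Fix an integer n ≥ 3. Let F be the free abelian group with basis {x_j^i : 1 ≤ i, j ≤ n} (so F ≅ ℤ^(n²)), and let N ≤ F be the subgroup generated by the following elements: (1) x_i^j − x_j^i for all 1 ≤ i < j ≤ n; (2) T₀ = Σ_{i=1}^n Σ_{j=1}^n x_j^i; (3) T_k = x_k^k for each 1 ≤ k ≤ n; and (4) C = Σ_{i=1}^n Σ_{j=1}^i x_j^i. Then the quotient group F / N is nontrivial. -/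
/-- The sum of the basis vectors `x_j^i` over `j ∈ s i` is the indicator function of `s`. -/
lemma sum_sum_single_apply_s8 {ι κ : Type*} [Fintype ι] [DecidableEq ι] [DecidableEq κ]
    (s : ι → Finset κ) (p : ι × κ) :
    (∑ i, ∑ j ∈ s i, (Pi.single (i, j) 1 : ι × κ → ℤ)) p = if p.2 ∈ s p.1 then 1 else 0 := by
  obtain ⟨a, c⟩ := p
  simp only [Finset.sum_apply, Pi.single_apply, Prod.mk.injEq]
  rw [Finset.sum_eq_single a]
  · simp
  · intro i _ hi
    simp [hi.symm]
  · simp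

/-- The functional `v ↦ (v_{ac} + v_{ca}) - (v_{ad} + v_{da})`, comparing the symmetrized
coordinates of `v` at the pairs `{a, c}` and `{a, d}`. -/
def symmCoordDiff {ι : Type*} (a c d : ι) : (ι × ι → ℤ) →ₗ[ℤ] ℤ :=
  let coord (p : ι × ι) : (ι × ι → ℤ) →ₗ[ℤ] ℤ := LinearMap.proj p
  coord (a, c) + coord (c, a) - (coord (a, d) + coord (d, a))

lemma symmCoordDiff_apply {ι : Type*} (a c d : ι) (v : ι × ι → ℤ) :
    symmCoordDiff a c d v = v (a, c) + v (c, a) - (v (a, d) + v (d, a)) := rfl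

/-- Paper's Example 3.9. Let `F` be the free abelian group with basis
`{x_j^i : 1 ≤ i, j ≤ n}` (here `b (i, j)` is the basis element `x_j^i`, with
superscript `i` the first coordinate and subscript `j` the second), and let `N ≤ F`
be the subgroup generated by:
(1) `x_i^j − x_j^i` for all `i < j`;
(2) `T₀ = Σ_i Σ_j x_j^i`;
(3) `T_k = x_k^k` for each `k`;
(4) `C = Σ_i Σ_{j ≤ i} x_j^i`.
Then for `n ≥ 3` the quotient `F / N` (the module of framings `Fr(Θ_n)`) is
nontrivial. -/
theorem stmt_8 (n : ℕ) (hn : 3 ≤ n)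
    (b : Fin n × Fin n → (Fin n × Fin n → ℤ))
    (hb : b = fun p => Pi.single p 1)
    (N : Submodule ℤ (Fin n × Fin n → ℤ))
    (hN : N = Submodule.span ℤ
      ({v | ∃ i j : Fin n, i < j ∧ v = b (j, i) - b (i, j)} ∪
       {∑ i : Fin n, ∑ j : Fin n, b (i, j)} ∪
       {v | ∃ k : Fin n, v = b (k, k)} ∪
       {∑ i : Fin n, ∑ j ∈ Finset.Iic i, b (i, j)})) :
    Nontrivial ((Fin n × Fin n → ℤ) ⧸ N) := by
  subst hb
  obtain ⟨a, c, d, hac, had, hcd⟩ : ∃ a c d : Fin n, a < c ∧ a < d ∧ c ≠ d :=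
    ⟨⟨0, by omega⟩, ⟨1, by omega⟩, ⟨2, by omega⟩, by simp, by simp, by simp⟩
  have hker : N ≤ LinearMap.ker (symmCoordDiff a c d) := by
    rw [hN, Submodule.span_le]
    rintro v (((⟨i, j, -, rfl⟩ | rfl) | ⟨k, rfl⟩) | rfl) <;>
      rw [SetLike.mem_coe, LinearMap.mem_ker, symmCoordDiff_apply]
    · simp only [Pi.sub_apply, Pi.single_apply, Prod.mk.injEq]
      grind
    · simp only [sum_sum_single_apply_s8]
      simp
    · simp only [Pi.single_apply, Prod.mk.injEq]
      grind
    · simp only [sum_sum_single_apply_s8]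
      simp [hac.le, had.le, hac.not_ge, had.not_ge]
  rw [Submodule.Quotient.nontrivial_iff]
  rintro rfl
  have h := hker (Submodule.mem_top (x := Pi.single (a, c) 1))
  rw [LinearMap.mem_ker, symmCoordDiff_apply] at h
  simp [hac.ne, hac.ne', had.ne', hcd.symm] at h
end
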